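/- Let M, N be finite simple undirected graphs, each having at least one edge. Let Ŵ(N) denote the set of nonnegative rational weight functions w on E(N) with total weight 1 that are invariant under the automorphism group of N, i.e. w(e) = w(π·e) for every edge e of N and every automorphism π of N. Then s(M,N) equals the infimum of mc_M(N,w) over all w ∈ Ŵ(N). -/

import Mathlib

open Finset
open scoped Classical

/-- The measure of a vertex map `f : V(G) → V(H)` as a solution to `(G,w)` of Max H-Col:
the total `w`-weight of the edges of `G` carried by `f` to edges of `H`. -/
noncomputable def mcMeasure {V W : Type} [Fintype V] (G : SimpleGraph V) (H : SimpleGraph W)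
    (w : Sym2 V → ℚ) (f : V → W) : ℚ :=
  ∑ e ∈ Finset.univ.filter (fun e : Sym2 V => e ∈ G.edgeSet ∧ Sym2.map f e ∈ H.edgeSet), w e

/-- `mc H (G,w)`: the maximum measure over all vertex maps `f : V(G) → V(H)`. -/
noncomputable def mc {V W : Type} [Fintype V] [Fintype W]
    (G : SimpleGraph V) (H : SimpleGraph W) (w : Sym2 V → ℚ) : ℝ :=
  ⨆ f : V → W, (mcMeasure G H w f : ℝ)

/-- A weight function on `G`: positive rational weights on the edges of `G`. -/
def IsWeight {V : Type} (G : SimpleGraph V) (w : Sym2 V → ℚ) : Prop :=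
  ∀ e ∈ G.edgeSet, 0 < w e

/-- `s(M,N)`: infimum of `mc_M(G,w)/mc_N(G,w)` over all graphs `G` with at least one
edge and all weight functions `w` on `G`. -/
noncomputable def sVal {V W : Type} [Fintype V] [Fintype W]
    (M : SimpleGraph V) (N : SimpleGraph W) : ℝ :=
  sInf { r : ℝ | ∃ (n : ℕ) (G : SimpleGraph (Fin n)) (w : Sym2 (Fin n) → ℚ),
    G.edgeSet.Nonempty ∧ IsWeight G w ∧ r = mc G M w / mc G N w }


section MaxHCol

variable {V W U : Type}

/-- The spanning subgraph of `G` formed by the edges of positive weight. -/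
def SimpleGraph.weightSupport (G : SimpleGraph V) (w : Sym2 V → ℚ) : SimpleGraph V :=
  SimpleGraph.fromEdgeSet {e | e ∈ G.edgeSet ∧ 0 < w e}

theorem SimpleGraph.mem_edgeSet_weightSupport {G : SimpleGraph V} {w : Sym2 V → ℚ} {e : Sym2 V} :
    e ∈ (G.weightSupport w).edgeSet ↔ e ∈ G.edgeSet ∧ 0 < w e := by
  rw [SimpleGraph.weightSupport, SimpleGraph.edgeSet_fromEdgeSet]
  exact ⟨fun h => h.1, fun h => ⟨h, fun hd => G.not_isDiag_of_mem_edgeSet h.1 hd⟩⟩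

variable [Fintype V]

theorem mcMeasure_le_mc [Fintype W] (G : SimpleGraph V) (H : SimpleGraph W) (w : Sym2 V → ℚ)
    (f : V → W) : (mcMeasure G H w f : ℝ) ≤ mc G H w :=
  le_ciSup (f := fun f : V → W => (mcMeasure G H w f : ℝ)) (Set.finite_range _).bddAbove f

theorem exists_mcMeasure_eq_mc [Fintype W] [Nonempty W] (G : SimpleGraph V) (H : SimpleGraph W)
    (w : Sym2 V → ℚ) : ∃ f : V → W, (mcMeasure G H w f : ℝ) = mc G H w :=
  exists_eq_ciSup_of_finite (f := fun f : V → W => (mcMeasure G H w f : ℝ))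

theorem mcMeasure_nonneg (G : SimpleGraph V) (H : SimpleGraph W) {w : Sym2 V → ℚ}
    (hw : ∀ e ∈ G.edgeSet, 0 ≤ w e) (f : V → W) : 0 ≤ mcMeasure G H w f :=
  Finset.sum_nonneg fun e he => hw e (Finset.mem_filter.1 he).2.1

theorem mc_nonneg [Fintype W] (G : SimpleGraph V) (H : SimpleGraph W) {w : Sym2 V → ℚ}
    (hw : ∀ e ∈ G.edgeSet, 0 ≤ w e) : 0 ≤ mc G H w :=
  Real.iSup_nonneg fun f => by exact_mod_cast mcMeasure_nonneg G H hw f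

theorem mcMeasure_le_sum (G : SimpleGraph V) (H : SimpleGraph W) {w : Sym2 V → ℚ}
    (hw : ∀ e ∈ G.edgeSet, 0 ≤ w e) (f : V → W) :
    mcMeasure G H w f ≤ ∑ e ∈ Finset.univ.filter (fun e : Sym2 V => e ∈ G.edgeSet), w e := by
  refine Finset.sum_le_sum_of_subset_of_nonneg (fun e he => ?_) fun e he _ => ?_
  · simp only [Finset.mem_filter, Finset.mem_univ, true_and] at he ⊢
    exact he.1
  · exact hw e (Finset.mem_filter.1 he).2

theorem mcMeasure_id (G : SimpleGraph V) (w : Sym2 V → ℚ) :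
    mcMeasure G G w id = ∑ e ∈ Finset.univ.filter (fun e : Sym2 V => e ∈ G.edgeSet), w e := by
  simp [mcMeasure]

/-- If `G` and `H` both have an edge and the weights are positive, the optimum is positive. -/
theorem mc_pos [Fintype W] {G : SimpleGraph V} {H : SimpleGraph W} {w : Sym2 V → ℚ}
    (hG : G.edgeSet.Nonempty) (hH : H.edgeSet.Nonempty) (hw : IsWeight G w) : 0 < mc G H w := by
  obtain ⟨e, he⟩ := hG
  obtain ⟨d, hd⟩ := hH
  induction e using Sym2.ind with | _ x y => ?_
  induction d using Sym2.ind with | _ a b => ?_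
  have hxy : y ≠ x := (G.ne_of_adj he).symm
  refine lt_of_lt_of_le ?_ (mcMeasure_le_mc G H w fun z => if z = x then a else b)
  refine Rat.cast_pos.2 (Finset.sum_pos (fun e he => hw e (Finset.mem_filter.1 he).2.1)
    ⟨s(x, y), ?_⟩)
  simp only [Finset.mem_filter, Finset.mem_univ, true_and, Sym2.map_mk, if_true, if_neg hxy]
  exact ⟨he, hd⟩

theorem mc_comap_equiv {V' : Type} [Fintype V'] [Fintype W] (σ : V' ≃ V) (G : SimpleGraph V)
    (H : SimpleGraph W) (w : Sym2 V → ℚ) :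
    mc (G.comap σ) H (fun e => w (Sym2.map σ e)) = mc G H w := by
  refine ((Equiv.arrowCongr σ (Equiv.refl W)).symm.iSup_congr fun f => ?_).symm
  refine congrArg _ (Finset.sum_bijective (Sym2.map σ)
    ⟨Sym2.map.injective σ.injective, fun e => ⟨Sym2.map σ.symm e, ?_⟩⟩ (fun e => ?_) fun e _ => ?_)
  · rw [Sym2.map_map, Equiv.self_comp_symm, Sym2.map_id, id]
  · induction e using Sym2.ind with | _ x y => simp [Equiv.arrowCongr]
  · rfl

theorem mc_weightSupport [Fintype W] (G : SimpleGraph V) (H : SimpleGraph W) {w : Sym2 V → ℚ}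
    (hw : ∀ e ∈ G.edgeSet, 0 ≤ w e) : mc (G.weightSupport w) H w = mc G H w := by
  refine iSup_congr fun f => congrArg _ (Finset.sum_subset (fun e he => ?_) fun e he hne => ?_)
  · simp only [Finset.mem_filter, Finset.mem_univ, true_and,
      SimpleGraph.mem_edgeSet_weightSupport] at he ⊢
    exact ⟨he.1.1, he.2⟩
  · simp only [Finset.mem_filter, Finset.mem_univ, true_and,
      SimpleGraph.mem_edgeSet_weightSupport] at he hne
    exact le_antisymm (not_lt.1 fun h => hne ⟨⟨he.1, h⟩, he.2⟩) (hw e he.1)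

/-- The optimum over maps to a fixed `M`, for a nonnegative weighting of total weight one on `N`,
is an upper bound for `s(M, N)`. -/
theorem sVal_le_mc {A B : Type} [Fintype A] [Fintype B] (M : SimpleGraph A) (N : SimpleGraph B)
    {w : Sym2 B → ℚ} (hw : ∀ e ∈ N.edgeSet, 0 ≤ w e)
    (hsum : ∑ e ∈ Finset.univ.filter (fun e : Sym2 B => e ∈ N.edgeSet), w e = 1) :
    sVal M N ≤ mc N M w := by
  have hone : mc N N w = 1 := by
    refine le_antisymm (Real.iSup_le (fun f => ?_) zero_le_one) ?_
    · exact_mod_cast (mcMeasure_le_sum N N hw f).trans hsum.le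
    · have h := mcMeasure_le_mc N N w id
      rwa [mcMeasure_id, hsum, Rat.cast_one] at h
  have hedge : ∃ e ∈ N.edgeSet, 0 < w e := by
    by_contra! h
    have : ∑ e ∈ Finset.univ.filter (fun e : Sym2 B => e ∈ N.edgeSet), w e ≤ 0 :=
      Finset.sum_nonpos fun e he => h e (Finset.mem_filter.1 he).2
    linarith
  let σ : Fin (Fintype.card B) ≃ B := (Fintype.equivFin B).symm
  have hmem : ∀ e, e ∈ ((N.weightSupport w).comap σ).edgeSet ↔
      Sym2.map σ e ∈ (N.weightSupport w).edgeSet := by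
    intro e
    induction e using Sym2.ind with | _ x y => simp
  refine csInf_le ⟨0, ?_⟩ ⟨Fintype.card B, (N.weightSupport w).comap σ,
    fun e => w (Sym2.map σ e), ?_, ?_, ?_⟩
  · rintro r ⟨n, G, v, -, hv, rfl⟩
    exact div_nonneg (mc_nonneg G M fun e he => (hv e he).le)
      (mc_nonneg G N fun e he => (hv e he).le)
  · obtain ⟨e, he⟩ := hedge
    refine ⟨Sym2.map σ.symm e, (hmem _).2 ?_⟩
    rw [Sym2.map_map, Equiv.self_comp_symm, Sym2.map_id]
    exact SimpleGraph.mem_edgeSet_weightSupport.2 he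
  · exact fun e he => (SimpleGraph.mem_edgeSet_weightSupport.1 ((hmem e).1 he)).2
  · rw [mc_comap_equiv, mc_comap_equiv, mc_weightSupport _ _ hw, mc_weightSupport _ _ hw, hone,
      div_one]

/-- The weight of `e` pushed forward along `f : V → W` from the edges of `G`. -/
noncomputable def pushWeight (G : SimpleGraph V) (w : Sym2 V → ℚ) (f : V → W) (e : Sym2 W) : ℚ :=
  ∑ d ∈ Finset.univ.filter (fun d : Sym2 V => d ∈ G.edgeSet ∧ Sym2.map f d = e), w d

theorem pushWeight_nonneg {G : SimpleGraph V} {w : Sym2 V → ℚ} (hw : ∀ e ∈ G.edgeSet, 0 ≤ w e)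
    (f : V → W) (e : Sym2 W) : 0 ≤ pushWeight G w f e :=
  Finset.sum_nonneg fun d hd => hw d (Finset.mem_filter.1 hd).2.1

theorem sum_pushWeight [Fintype W] (G : SimpleGraph V) (w : Sym2 V → ℚ) (f : V → W)
    (P : Sym2 W → Prop) [DecidablePred P] :
    ∑ e ∈ Finset.univ.filter P, pushWeight G w f e =
      ∑ d ∈ Finset.univ.filter (fun d : Sym2 V => d ∈ G.edgeSet ∧ P (Sym2.map f d)), w d := by
  rw [← Finset.sum_fiberwise_of_maps_to (g := Sym2.map f) (t := Finset.univ.filter P)]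
  · refine Finset.sum_congr rfl fun e he => Finset.sum_congr ?_ fun _ _ => rfl
    have hP := (Finset.mem_filter.1 he).2
    ext d
    simp only [Finset.mem_filter, Finset.mem_univ, true_and]
    constructor
    · rintro ⟨h, rfl⟩
      exact ⟨⟨h, hP⟩, rfl⟩
    · exact fun h => ⟨h.1.1, h.2⟩
  · intro d hd
    simp only [Finset.mem_filter, Finset.mem_univ, true_and] at hd ⊢
    exact hd.2

theorem mcMeasure_pushWeight_le [Fintype W] (G : SimpleGraph V) (N : SimpleGraph W)
    (M : SimpleGraph U) {w : Sym2 V → ℚ} (hw : ∀ e ∈ G.edgeSet, 0 ≤ w e) (f : V → W) (g : W → U) :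
    mcMeasure N M (pushWeight G w f) g ≤ mcMeasure G M w (g ∘ f) := by
  rw [mcMeasure, sum_pushWeight, mcMeasure]
  refine Finset.sum_le_sum_of_subset_of_nonneg (fun d hd => ?_) fun d hd _ => ?_
  · simp only [Finset.mem_filter, Finset.mem_univ, true_and, Sym2.map_map] at hd ⊢
    exact ⟨hd.1, hd.2.2⟩
  · exact hw d (Finset.mem_filter.1 hd).2.1

theorem pushWeight_equiv_comp (G : SimpleGraph V) (w : Sym2 V → ℚ) (f : V → W) (ρ : W ≃ W)
    (e : Sym2 W) : pushWeight G w (ρ ∘ f) (Sym2.map ρ e) = pushWeight G w f e := by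
  refine Finset.sum_congr (Finset.filter_congr fun d _ => ?_) fun _ _ => rfl
  rw [← Sym2.map_map, (Sym2.map.injective ρ.injective).eq_iff]

/-- Every instance is dominated by an automorphism-invariant weighting of `N`: push the weights
forward along an optimal map and average over the automorphisms of `N`. -/
theorem exists_invariant_weight_mc_le {A B : Type} [Fintype A] [Fintype B]
    {M : SimpleGraph A} {N : SimpleGraph B} (hN : N.edgeSet.Nonempty)
    {G : SimpleGraph V} {w : Sym2 V → ℚ} (hG : G.edgeSet.Nonempty) (hw : IsWeight G w) :
    ∃ v : Sym2 B → ℚ, (∀ e ∈ N.edgeSet, 0 ≤ v e) ∧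
      (∑ e ∈ Finset.univ.filter (fun e : Sym2 B => e ∈ N.edgeSet), v e) = 1 ∧
      (∀ e ∈ N.edgeSet, ∀ π : N ≃g N, v (Sym2.map (⇑π) e) = v e) ∧
      mc N M v ≤ mc G M w / mc G N w := by
  have hw0 : ∀ e ∈ G.edgeSet, 0 ≤ w e := fun e he => (hw e he).le
  have : Nonempty B := by
    obtain ⟨e, -⟩ := hN
    exact ⟨e.out.1⟩
  have : Finite (N ≃g N) := DFunLike.finite _
  let _ : Fintype (N ≃g N) := Fintype.ofFinite _
  obtain ⟨f, hf⟩ := exists_mcMeasure_eq_mc G N w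
  have hpos := mc_pos hG hN hw
  rw [← hf] at hpos ⊢
  set q := mcMeasure G N w f with hq
  have hq0 : 0 < q := by exact_mod_cast hpos
  set k : ℚ := (Fintype.card (N ≃g N) : ℚ) with hk
  have hk0 : 0 < k := by
    rw [hk]
    exact_mod_cast Fintype.card_pos_iff.2 ⟨SimpleGraph.Iso.refl⟩
  have hsum : ∀ (P : Sym2 B → Prop) [DecidablePred P],
      ∑ e ∈ Finset.univ.filter P, (∑ π : N ≃g N, pushWeight G w (π ∘ f) e) / (k * q) =
        (∑ π : N ≃g N, ∑ e ∈ Finset.univ.filter P, pushWeight G w (π ∘ f) e) / (k * q) := by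
    intro P _
    rw [← Finset.sum_div, Finset.sum_comm]
  refine ⟨fun e => (∑ π : N ≃g N, pushWeight G w (π ∘ f) e) / (k * q), ?_, ?_, ?_, ?_⟩
  · intro e _
    exact div_nonneg (Finset.sum_nonneg fun π _ => pushWeight_nonneg hw0 _ e) (by positivity)
  · rw [hsum, div_eq_one_iff_eq (by positivity)]
    have hπ : ∀ π : N ≃g N,
        ∑ e ∈ Finset.univ.filter (fun e : Sym2 B => e ∈ N.edgeSet), pushWeight G w (π ∘ f) e
          = q := by
      intro π
      rw [sum_pushWeight, hq, mcMeasure]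
      refine Finset.sum_congr (Finset.filter_congr fun d _ => ?_) fun _ _ => rfl
      induction d using Sym2.ind with | _ x y => simp [π.map_adj_iff]
    simp [hπ, hk]
  · intro e _ ρ
    refine congrArg (· / (k * q)) ?_
    refine (Equiv.sum_comp (Equiv.mulLeft (ρ : N ≃g N))
      fun π : N ≃g N => pushWeight G w (π ∘ f) (Sym2.map ρ e)).symm.trans ?_
    exact Finset.sum_congr rfl fun π _ => pushWeight_equiv_comp G w (π ∘ f) ρ.toEquiv e
  · refine Real.iSup_le (fun g => ?_) (div_nonneg (mc_nonneg G M hw0) hpos.le)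
    have hπ : ∀ π : N ≃g N, (mcMeasure N M (pushWeight G w (π ∘ f)) g : ℝ) ≤ mc G M w :=
      fun π => le_trans (by exact_mod_cast mcMeasure_pushWeight_le G N M hw0 (π ∘ f) g)
        (mcMeasure_le_mc G M w (g ∘ π ∘ f))
    have hle : ∑ π : N ≃g N, (mcMeasure N M (pushWeight G w (π ∘ f)) g : ℝ) ≤ k * mc G M w := by
      refine (Finset.sum_le_sum fun π _ => hπ π).trans_eq ?_
      simp [hk]
    have hkR : (0 : ℝ) < k := by exact_mod_cast hk0
    rw [mcMeasure, hsum, Rat.cast_div, Rat.cast_mul, Rat.cast_sum,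
      div_le_div_iff₀ (by positivity) hpos]
    calc _ ≤ (k * mc G M w) * (q : ℝ) := mul_le_mul_of_nonneg_right hle hpos.le
      _ = _ := by ring

end MaxHCol

/-- `s(M,N)` equals the infimum of `mc_M(N,w)` over all nonnegative,
automorphism-invariant weight functions `w` on `E(N)` of total weight `1`. -/
theorem stmt11 {A B : Type} [Fintype A] [Fintype B]
    (M : SimpleGraph A) (N : SimpleGraph B)
    (hM : M.edgeSet.Nonempty) (hN : N.edgeSet.Nonempty) :
    sVal M N = sInf { r : ℝ | ∃ w : Sym2 B → ℚ,
      (∀ e ∈ N.edgeSet, 0 ≤ w e) ∧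
      (∑ e ∈ Finset.univ.filter (fun e : Sym2 B => e ∈ N.edgeSet), w e) = 1 ∧
      (∀ e ∈ N.edgeSet, ∀ π : N ≃g N, w (Sym2.map (⇑π) e) = w e) ∧
      r = mc N M w } := by
  have hG₂ : (⊤ : SimpleGraph (Fin 2)).edgeSet.Nonempty := ⟨s(0, 1), by simp⟩
  have hw₂ : IsWeight (⊤ : SimpleGraph (Fin 2)) fun _ => 1 := fun _ _ => one_pos
  rw [sVal]
  refine le_antisymm (le_csInf ?_ ?_) (le_csInf ?_ ?_)
  · obtain ⟨v, h0, h1, hinv, -⟩ := exists_invariant_weight_mc_le (M := M) hN hG₂ hw₂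
    exact ⟨_, v, h0, h1, hinv, rfl⟩
  · rintro r ⟨w, h0, h1, -, rfl⟩
    exact sVal_le_mc M N h0 h1
  · exact ⟨_, 2, ⊤, _, hG₂, hw₂, rfl⟩
  · rintro r ⟨n, G, w, hG, hw, rfl⟩
    obtain ⟨v, h0, h1, hinv, hle⟩ := exists_invariant_weight_mc_le (M := M) hN hG hw
    refine le_trans (csInf_le ⟨0, ?_⟩ ⟨v, h0, h1, hinv, rfl⟩) hle
    rintro r ⟨u, hu, -, -, rfl⟩
    exact mc_nonneg N M hu
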